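/- arXiv:2003.02887 — 2 statements merged into one kernel-verified Lean document; each statement's English description precedes it below -/
import Mathlib

section
/- For every k ≥ 2 there exists a string s : {1,…,k} → {−1,+1} such that s(i·j) = s(i)·s(j) whenever i·j ≤ k, and |∑_{i=1}^{k} s(i)| ≤ 1. -/
open Finset

/-- The completely multiplicative sign function that is `-1` exactly at the primes in `A`. -/
def sg (A : Finset ℕ) (n : ℕ) : ℤ := ∏ p ∈ A, (-1) ^ (n.factorization p)

theorem sg_mul (A : Finset ℕ) {m n : ℕ} (hm : 1 ≤ m) (hn : 1 ≤ n) :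
    sg A (m * n) = sg A m * sg A n := by
  unfold sg
  rw [← Finset.prod_mul_distrib]
  refine Finset.prod_congr rfl fun p _ => ?_
  rw [Nat.factorization_mul (by omega) (by omega), Finsupp.add_apply, pow_add]

theorem sg_pm (A : Finset ℕ) (n : ℕ) : sg A n = 1 ∨ sg A n = -1 := by
  unfold sg
  induction A using Finset.induction_on with
  | empty => simp
  | insert a s ha ih =>
    rw [Finset.prod_insert ha]
    rcases neg_one_pow_eq_or ℤ (n.factorization a) with h | h <;> rcases ih with h' | h' <;>
      simp [h, h']

theorem sg_large (k : ℕ) (B : Finset ℕ) (hB : ∀ p ∈ B, p.Prime ∧ k < 2 * p) (n : ℕ)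
    (hn : 1 ≤ n) (hnk : n ≤ k) : sg B n = if n ∈ B then -1 else 1 := by
  have key : ∀ p ∈ B, p ≠ n → n.factorization p = 0 := by
    intro p hp hpn
    apply Nat.factorization_eq_zero_of_not_dvd
    rintro ⟨c, rfl⟩
    have := (hB p hp).2
    rcases c with _ | _ | c
    · omega
    · simp at hpn
    · nlinarith
  unfold sg
  split_ifs with h
  · rw [Finset.prod_eq_single n]
    · simp [(hB n h).1.factorization_self]
    · intro p hp hpn
      simp [key p hp hpn]
    · intro h'; exact absurd h h'
  · refine Finset.prod_eq_one fun p hp => ?_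
    rw [key p hp (by rintro rfl; exact h hp), pow_zero]

theorem flip_seed (k : ℕ) (f : ℕ → ℤ) (hf : ∀ n, 1 ≤ n → f n = 1 ∨ f n = -1)
    (hmul : ∀ i j, 1 ≤ i → 1 ≤ j → f (i * j) = f i * f j) (P : Finset ℕ)
    (hP : ∀ p ∈ P, p.Prime ∧ p ≤ k ∧ k < 2 * p ∧ f p = 1)
    (h0 : 0 ≤ ∑ i ∈ Finset.Icc 1 k, f i) (h1 : ∑ i ∈ Finset.Icc 1 k, f i ≤ 2 * (P.card : ℤ) + 1) :
    ∃ s : ℕ → ℤ,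
      (∀ i : ℕ, 1 ≤ i → i ≤ k → s i = 1 ∨ s i = -1) ∧
      (∀ i j : ℕ, 1 ≤ i → 1 ≤ j → i * j ≤ k → s (i * j) = s i * s j) ∧
      |∑ i ∈ Finset.Icc 1 k, s i| ≤ 1 := by
  set F := ∑ i ∈ Finset.Icc 1 k, f i with hF
  obtain ⟨B, hBP, hBc⟩ := Finset.exists_subset_card_eq (s := P) (n := (F / 2).toNat) (by omega)
  refine ⟨fun n => f n * sg B n, ?_, ?_, ?_⟩
  · intro i hi _
    rcases hf i hi with h | h <;> rcases sg_pm B i with h' | h' <;> simp [h, h']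
  · intro i j hi hj _
    simp only [hmul i j hi hj, sg_mul B hi hj]
    ring
  · have e : ∀ n ∈ Finset.Icc 1 k, f n * sg B n = f n - if n ∈ B then 2 else 0 := by
      intro n hn
      rw [Finset.mem_Icc] at hn
      rw [sg_large k B (fun p hp => ⟨(hP p (hBP hp)).1, (hP p (hBP hp)).2.2.1⟩) n hn.1 hn.2]
      split_ifs with h
      · rw [(hP n (hBP h)).2.2.2]; norm_num
      · ring
    rw [Finset.sum_congr rfl e, Finset.sum_sub_distrib, ← hF, ← Finset.sum_filter]
    have : Finset.filter (fun n => n ∈ B) (Finset.Icc 1 k) = B := by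
      ext n
      simp only [Finset.mem_filter, Finset.mem_Icc]
      refine ⟨fun h => h.2, fun h => ⟨⟨(hP n (hBP h)).1.one_lt.le, (hP n (hBP h)).2.1⟩, h⟩⟩
    rw [this, Finset.sum_const, hBc, nsmul_eq_mul, abs_le]
    have : (((F / 2).toNat : ℕ) : ℤ) = F / 2 := Int.toNat_of_nonneg (by omega)
    rw [this]
    constructor <;> omega

/-! ### Second moment -/

theorem sum_sg (R : Finset ℕ) (n : ℕ) (hn : 1 ≤ n) (hR : n.primeFactors ⊆ R) :
    ∑ A ∈ R.powerset, sg A n ≤ if IsSquare n then 2 ^ R.card else 0 := by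
  unfold sg
  rw [← Finset.prod_one_add]
  split_ifs with h
  · rw [← Finset.prod_const]
    apply Finset.prod_le_prod
    · intro p _
      rcases neg_one_pow_eq_or ℤ (n.factorization p) with h | h <;> simp [h]
    · intro p _
      rcases neg_one_pow_eq_or ℤ (n.factorization p) with h | h <;> simp [h]
  · apply le_of_eq
    have : ∃ p, Odd (n.factorization p) := by
      by_contra hc
      push Not at hc
      apply h
      refine ⟨∏ p ∈ n.primeFactors, p ^ (n.factorization p / 2), ?_⟩
      rw [← Finset.prod_mul_distrib]
      conv_lhs => rw [← Nat.prod_factorization_pow_eq_self (n := n) (by omega)]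
      rw [Nat.prod_factorization_eq_prod_primeFactors]
      refine Finset.prod_congr rfl fun p _ => ?_
      rw [← pow_add]
      congr 1
      have := Nat.not_odd_iff_even.1 (hc p)
      obtain ⟨r, hr⟩ := this
      omega
    obtain ⟨p, hp⟩ := this
    refine Finset.prod_eq_zero (i := p) (hR ?_) (by simp [hp.neg_one_pow])
    rw [← Nat.support_factorization, Finsupp.mem_support_iff]
    intro h0
    rw [h0] at hp
    exact absurd hp (by decide)

theorem count_sq (k : ℕ) :
    (((Finset.Icc 1 k) ×ˢ (Finset.Icc 1 k)).filter (fun x => IsSquare (x.1 * x.2))).card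
      ≤ ∑ a ∈ Finset.Icc 1 k, k / a := by
  have hsub : ((Finset.Icc 1 k) ×ˢ (Finset.Icc 1 k)).filter (fun x => IsSquare (x.1 * x.2)) ⊆
      (Finset.Icc 1 k).biUnion (fun a => ((Finset.Icc 1 (Nat.sqrt (k / a))) ×ˢ
        (Finset.Icc 1 (Nat.sqrt (k / a)))).image (fun y => (a * y.1 ^ 2, a * y.2 ^ 2))) := by
    rintro ⟨m, n⟩ h
    simp only [Finset.mem_filter, Finset.mem_product, Finset.mem_Icc] at h
    obtain ⟨⟨⟨hm1, hmk⟩, hn1, hnk⟩, r, hr⟩ := h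
    obtain ⟨g, m', n', hg, hco, rfl, rfl⟩ := Nat.exists_coprime' (m := m) (n := n)
      (Nat.gcd_pos_of_pos_left _ hm1)
    have hgr : g ∣ r := by
      rw [← Nat.pow_dvd_pow_iff (n := 2) (by norm_num)]
      exact ⟨m' * n', by rw [sq r, ← hr]; ring⟩
    obtain ⟨t, rfl⟩ := hgr
    have ht : m' * n' = t ^ 2 := by
      have : g ^ 2 * (m' * n') = g ^ 2 * t ^ 2 := by linarith [hr, sq_nonneg g]
      exact Nat.eq_of_mul_eq_mul_left (by positivity) this
    obtain ⟨b, hb⟩ := exists_eq_pow_of_mul_eq_pow (Nat.isUnit_iff.2 hco) ht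
    obtain ⟨c, hc⟩ := exists_eq_pow_of_mul_eq_pow (Nat.isUnit_iff.2 hco.symm) (by rw [mul_comm]; exact ht)
    subst hb hc
    simp only [Finset.mem_biUnion, Finset.mem_image, Finset.mem_product, Finset.mem_Icc,
      Prod.mk.injEq, Prod.exists]
    have hb1 : 1 ≤ b := by
      rcases Nat.eq_zero_or_pos b with h | h
      · simp [h] at hm1
      · exact h
    have hc1 : 1 ≤ c := by
      rcases Nat.eq_zero_or_pos c with h | h
      · simp [h] at hn1
      · exact h
    refine ⟨g, ⟨hg, ?_⟩, b, c, ⟨⟨hb1, ?_⟩, hc1, ?_⟩, by ring, by ring⟩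
    · nlinarith [Nat.one_le_pow 2 b hb1]
    · rw [Nat.le_sqrt', Nat.le_div_iff_mul_le hg]; exact hmk
    · rw [Nat.le_sqrt', Nat.le_div_iff_mul_le hg]; exact hnk
  refine (Finset.card_le_card hsub).trans (Finset.card_biUnion_le.trans ?_)
  refine Finset.sum_le_sum fun a _ => Finset.card_image_le.trans ?_
  rw [Finset.card_product, Nat.card_Icc, Nat.add_sub_cancel]
  exact Nat.sqrt_le _

theorem count_bound (k u : ℕ) (hk : 1 ≤ k) (hu : 4 ≤ u) (hku : k < 2 ^ u) :
    ∑ a ∈ Finset.Icc 1 k, k / a ≤ k * u := by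
  have h1 : ((∑ a ∈ Finset.Icc 1 k, k / a : ℕ) : ℝ) ≤ k * (1 + Real.log k) := by
    have h := harmonic_le_one_add_log k
    rw [harmonic_eq_sum_Icc] at h
    push_cast at h ⊢
    calc ∑ a ∈ Finset.Icc 1 k, ((k / a : ℕ) : ℝ) ≤ ∑ a ∈ Finset.Icc 1 k, (k : ℝ) * (a : ℝ)⁻¹ :=
          Finset.sum_le_sum fun a _ => by rw [← div_eq_mul_inv]; exact Nat.cast_div_le
      _ = k * ∑ a ∈ Finset.Icc 1 k, (a : ℝ)⁻¹ := by rw [Finset.mul_sum]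
      _ ≤ _ := by gcongr
  have h2 : Real.log k ≤ u * Real.log 2 := by
    rw [← Real.log_pow]
    apply Real.log_le_log (by exact_mod_cast hk)
    exact_mod_cast hku.le
  have h3 := Real.log_two_lt_d9
  have h4 : (4 : ℝ) ≤ u := by exact_mod_cast hu
  have h5 : 1 + Real.log k ≤ u := by nlinarith
  have : ((∑ a ∈ Finset.Icc 1 k, k / a : ℕ) : ℝ) ≤ ((k * u : ℕ) : ℝ) := by
    push_cast at h1 ⊢
    exact h1.trans (by gcongr)
  exact_mod_cast this

theorem second_moment (k : ℕ) (N R : Finset ℕ) (hN : N ⊆ Finset.Icc 1 k)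
    (hR : ∀ n ∈ N, n.primeFactors ⊆ R) :
    ∃ A ∈ R.powerset, (∑ n ∈ N, sg A n) ^ 2 ≤ ((∑ a ∈ Finset.Icc 1 k, k / a : ℕ) : ℤ) := by
  apply Finset.exists_le_of_sum_le ⟨∅, Finset.empty_mem_powerset R⟩
  have hpos : ∀ n ∈ N, 1 ≤ n := fun n hn => (Finset.mem_Icc.1 (hN hn)).1
  calc ∑ A ∈ R.powerset, (∑ n ∈ N, sg A n) ^ 2
      = ∑ A ∈ R.powerset, ∑ x ∈ N ×ˢ N, sg A (x.1 * x.2) := by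
        refine Finset.sum_congr rfl fun A _ => ?_
        rw [sq, Finset.sum_mul_sum, ← Finset.sum_product']
        refine Finset.sum_congr rfl fun x hx => ?_
        rw [Finset.mem_product] at hx
        rw [sg_mul A (hpos _ hx.1) (hpos _ hx.2)]
    _ = ∑ x ∈ N ×ˢ N, ∑ A ∈ R.powerset, sg A (x.1 * x.2) := Finset.sum_comm
    _ ≤ ∑ x ∈ N ×ˢ N, if IsSquare (x.1 * x.2) then (2 : ℤ) ^ R.card else 0 := by
        refine Finset.sum_le_sum fun x hx => ?_
        rw [Finset.mem_product] at hx
        have h1 := hpos _ hx.1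
        have h2 := hpos _ hx.2
        refine sum_sg R _ (Nat.mul_pos h1 h2) ?_
        rw [Nat.primeFactors_mul (by omega) (by omega)]
        exact Finset.union_subset (hR _ hx.1) (hR _ hx.2)
    _ = ((N ×ˢ N).filter (fun x => IsSquare (x.1 * x.2))).card * (2 : ℤ) ^ R.card := by
        rw [← Finset.sum_filter, Finset.sum_const, nsmul_eq_mul]
    _ ≤ ((∑ a ∈ Finset.Icc 1 k, k / a : ℕ) : ℤ) * (2 : ℤ) ^ R.card := by
        gcongr
        refine le_trans (Finset.card_le_card ?_) (count_sq k)
        exact Finset.filter_subset_filter _ (Finset.product_subset_product hN hN)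
    _ = _ := by
        rw [Finset.sum_const, Finset.card_powerset, nsmul_eq_mul]
        push_cast
        ring

/-! ### Many primes in `(n, 2n]` -/

/-- The primes in `(n, 2n]`. -/
def bp (n : ℕ) : Finset ℕ := (Finset.Ioc n (2 * n)).filter Nat.Prime

theorem centralBinom_le_bp (n : ℕ) (n_large : 2 < n) :
    n.centralBinom ≤ (2 * n) ^ Nat.sqrt (2 * n) * 4 ^ (2 * n / 3) * (2 * n) ^ (bp n).card := by
  have n_pos : 0 < n := (Nat.zero_le _).trans_lt n_large
  have n2_pos : 1 ≤ 2 * n := by omega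
  let f x := x ^ n.centralBinom.factorization x
  have hsplit : n.centralBinom = (∏ x ∈ Finset.range (2 * n / 3 + 1), f x) * ∏ x ∈ bp n, f x := by
    rw [← Finset.prod_union]
    · conv_lhs => rw [← n.prod_pow_factorization_centralBinom]
      symm
      apply Finset.prod_subset
      · intro x hx
        simp only [bp, Finset.mem_union, Finset.mem_range, Finset.mem_filter,
          Finset.mem_Ioc] at hx ⊢
        omega
      · intro x hx hx'
        simp only [bp, Finset.mem_union, Finset.mem_range, Finset.mem_filter,
          Finset.mem_Ioc, not_or, not_and] at hx hx'
        dsimp only [f]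
        by_cases hp : x.Prime
        · have hxn : x ≤ n := by
            by_contra hc
            exact hx'.2 ⟨by omega, by omega⟩ hp
          rw [Nat.factorization_centralBinom_of_two_mul_self_lt_three_mul n_large hxn (by omega),
            Nat.pow_zero]
        · rw [Nat.factorization_eq_zero_of_not_prime n.centralBinom hp, Nat.pow_zero]
    · rw [Finset.disjoint_left]
      intro x hx hx'
      simp only [bp, Finset.mem_range, Finset.mem_filter, Finset.mem_Ioc] at hx hx'
      omega
  let S := {p ∈ Finset.range (2 * n / 3 + 1) | Nat.Prime p}
  have : ∏ x ∈ S, f x = ∏ x ∈ Finset.range (2 * n / 3 + 1), f x := by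
    refine Finset.prod_filter_of_ne fun p _ h => ?_
    contrapose h; dsimp only [f]
    rw [Nat.factorization_eq_zero_of_not_prime n.centralBinom h, _root_.pow_zero]
  have hf : ∀ p, f p ≤ 2 * n := fun p => Nat.pow_factorization_choose_le (by omega)
  rw [hsplit, ← this, ← Finset.prod_filter_mul_prod_filter_not S (· ≤ Nat.sqrt (2 * n))]
  apply mul_le_mul'
  · apply mul_le_mul'
    · refine (Finset.prod_le_prod' fun p _ => hf p).trans ?_
      have : (Finset.Icc 1 (Nat.sqrt (2 * n))).card = Nat.sqrt (2 * n) := by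
        rw [Nat.card_Icc, Nat.add_sub_cancel]
      rw [Finset.prod_const]
      refine pow_right_mono₀ n2_pos ((Finset.card_le_card fun x hx => ?_).trans this.le)
      obtain ⟨h1, h2⟩ := Finset.mem_filter.1 hx
      exact Finset.mem_Icc.mpr ⟨(Finset.mem_filter.1 h1).2.one_lt.le, h2⟩
    · refine le_trans ?_ (primorial_le_four_pow (2 * n / 3))
      refine (Finset.prod_le_prod' fun p hp => (?_ : f p ≤ p)).trans ?_
      · obtain ⟨h1, h2⟩ := Finset.mem_filter.1 hp
        refine (pow_right_mono₀ (Finset.mem_filter.1 h1).2.one_lt.le ?_).trans (pow_one p).le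
        exact Nat.factorization_choose_le_one (Nat.sqrt_lt'.mp <| not_le.1 h2)
      refine Finset.prod_le_prod_of_subset_of_one_le' (Finset.filter_subset _ _) ?_
      exact fun p hp _ => (Finset.mem_filter.1 hp).2.one_lt.le
  · refine (Finset.prod_le_prod' fun p _ => hf p).trans ?_
    rw [Finset.prod_const]

theorem bp_lower (n u : ℕ) (n_large : 4 ≤ n) (hu : 2 * n ≤ 2 ^ u) :
    2 * n ≤ 3 * u * (Nat.sqrt (2 * n) + (bp n).card + 1) := by
  have h1 := Nat.four_pow_lt_mul_centralBinom n n_large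
  have h2 := centralBinom_le_bp n (by omega)
  set r := Nat.sqrt (2 * n)
  set Q := (bp n).card
  have h3 : 4 ^ n < 2 ^ (u * (r + Q + 1) + 2 * (2 * n / 3)) := by
    calc 4 ^ n < n * n.centralBinom := h1
      _ ≤ (2 * n) * ((2 * n) ^ r * 4 ^ (2 * n / 3) * (2 * n) ^ Q) := by gcongr; omega
      _ = (2 * n) ^ (r + Q + 1) * 4 ^ (2 * n / 3) := by ring
      _ ≤ (2 ^ u) ^ (r + Q + 1) * 4 ^ (2 * n / 3) := by gcongr
      _ = _ := by
        rw [← pow_mul, pow_add, show (4 : ℕ) = 2 ^ 2 by norm_num, ← pow_mul]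
  rw [show (4 : ℕ) = 2 ^ 2 by norm_num, ← pow_mul] at h3
  have h4 := (Nat.pow_lt_pow_iff_right (by norm_num : 1 < 2)).1 h3
  rw [mul_assoc]
  omega

theorem pow_cube (j : ℕ) (hj : 17 ≤ j) : 20 * (j + 1) ^ 3 ≤ 2 ^ j := by
  induction j, hj using Nat.le_induction with
  | base => norm_num
  | succ m hm ih =>
    have e : (2 : ℕ) ^ (m + 1) = 2 * 2 ^ m := by ring
    rw [e]
    nlinarith [mul_le_mul hm hm (by omega) (by omega),
      mul_le_mul hm (mul_le_mul hm hm (by omega) (by omega)) (by omega) (by omega)]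

theorem Q_large (k u : ℕ) (hu : 18 ≤ u) (h1 : 2 ^ (u - 1) ≤ k) (h2 : k < 2 ^ u) :
    k * u ≤ (bp (k / 2)).card ^ 2 := by
  have hcube : 20 * u ^ 3 ≤ k := by
    have := pow_cube (u - 1) (by omega)
    rw [show u - 1 + 1 = u by omega] at this
    omega
  have hk : 131072 ≤ k := by
    have : 2 ^ 17 ≤ 2 ^ (u - 1) := Nat.pow_le_pow_right (by norm_num) (by omega)
    omega
  have hb := bp_lower (k / 2) u (by omega) (by omega)
  set Q := (bp (k / 2)).card
  by_contra hc
  push Not at hc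
  have hr : Nat.sqrt (2 * (k / 2)) ≤ Nat.sqrt k := Nat.sqrt_le_sqrt (by omega)
  have hb2 : k ≤ 3 * u * (Nat.sqrt k + Q + 1) + 1 := by
    have : 3 * u * (Nat.sqrt (2 * (k / 2)) + Q + 1) ≤ 3 * u * (Nat.sqrt k + Q + 1) := by gcongr
    omega
  have hb3 : (k : ℝ) ≤ 3 * u * (√k + Q + 1) + 1 := by
    have h : (k : ℝ) ≤ 3 * u * (Nat.sqrt k + Q + 1) + 1 := by exact_mod_cast hb2
    have h' : (Nat.sqrt k : ℝ) ≤ √k := Real.nat_sqrt_le_real_sqrt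
    have : 3 * (u : ℝ) * (Nat.sqrt k + Q + 1) ≤ 3 * u * (√k + Q + 1) := by gcongr
    linarith
  set x := √(k : ℝ) with hx
  set v := √(u : ℝ) with hv
  have hx2 : x ^ 2 = k := Real.sq_sqrt (by positivity)
  have hv2 : v ^ 2 = u := Real.sq_sqrt (by positivity)
  have hx0 : 0 ≤ x := Real.sqrt_nonneg _
  have hv0 : 0 ≤ v := Real.sqrt_nonneg _
  have hQ : (Q : ℝ) ≤ x * v := by
    refine (sq_le_sq₀ (by positivity) (by positivity)).1 ?_
    rw [mul_pow, hx2, hv2]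
    exact_mod_cast hc.le
  have hv4 : 4.2 ≤ v := by
    apply Real.le_sqrt_of_sq_le
    have : (18 : ℝ) ≤ u := by exact_mod_cast hu
    norm_num
    linarith
  have hxv : 4.4 * v ^ 3 ≤ x := by
    apply Real.le_sqrt_of_sq_le
    have : (20 : ℝ) * u ^ 3 ≤ k := by exact_mod_cast hcube
    rw [← hv2] at this
    have h6 : 0 ≤ v ^ 6 := by positivity
    nlinarith
  rw [← hx2, ← hv2] at hb3
  have a1 : 3 * v ^ 2 * Q ≤ 3 * v ^ 2 * (x * v) := by gcongr
  have a2 : 4.4 * v ^ 3 * x ≤ x * x := by gcongr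
  have a3 : 4.2 * (v ^ 2 * x) ≤ v * (v ^ 2 * x) := by gcongr
  have hv17 : 17 ≤ v ^ 2 := by nlinarith
  have a4 : 300 ≤ x := by nlinarith [mul_le_mul hv4 hv17 (by norm_num) hv0]
  have a5 : 300 * v ^ 2 ≤ x * v ^ 2 := by gcongr
  nlinarith

theorem large_case (k : ℕ) (hk : 131072 ≤ k) :
    ∃ s : ℕ → ℤ,
      (∀ i : ℕ, 1 ≤ i → i ≤ k → s i = 1 ∨ s i = -1) ∧
      (∀ i j : ℕ, 1 ≤ i → 1 ≤ j → i * j ≤ k → s (i * j) = s i * s j) ∧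
      |∑ i ∈ Finset.Icc 1 k, s i| ≤ 1 := by
  have hj1 : 2 ^ Nat.log 2 k ≤ k := Nat.pow_log_le_self 2 (by omega)
  have hj2 : k < 2 ^ (Nat.log 2 k + 1) := Nat.lt_pow_succ_log_self (by norm_num) k
  have hj3 : 17 ≤ Nat.log 2 k := Nat.le_log_of_pow_le (by norm_num) (by omega)
  set u := Nat.log 2 k + 1 with hu
  have hQ := Q_large k u (by omega) (by simpa [hu] using hj1) hj2
  have hcount := count_bound k u (by omega) (by omega) hj2
  set P := bp (k / 2) with hPdef
  have hP : ∀ p ∈ P, p.Prime ∧ p ≤ k ∧ k < 2 * p := by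
    intro p hp
    simp only [hPdef, bp, Finset.mem_filter, Finset.mem_Ioc] at hp
    exact ⟨hp.2, by omega, by omega⟩
  have hPsub : P ⊆ Finset.Icc 1 k := fun p hp =>
    Finset.mem_Icc.2 ⟨(hP p hp).1.one_lt.le, (hP p hp).2.1⟩
  obtain ⟨A, hA, hT⟩ := second_moment k (Finset.Icc 1 k \ P) (Finset.Icc 1 k \ P)
    Finset.sdiff_subset (by
      intro n hn p hp
      rw [Finset.mem_sdiff, Finset.mem_Icc] at hn ⊢
      have hpp := Nat.prime_of_mem_primeFactors hp
      have hpd := Nat.dvd_of_mem_primeFactors hp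
      have hpn := Nat.le_of_dvd (by omega) hpd
      refine ⟨⟨hpp.one_lt.le, by omega⟩, fun hpP => ?_⟩
      obtain ⟨c, rfl⟩ := hpd
      have := (hP p hpP).2.2
      rcases c with _ | _ | c
      · omega
      · exact hn.2 (by simpa using hpP)
      · nlinarith)
  rw [Finset.mem_powerset] at hA
  set T := ∑ n ∈ Finset.Icc 1 k \ P, sg A n with hTdef
  have hsgP : ∀ p ∈ P, sg A p = 1 := by
    intro p hp
    refine Finset.prod_eq_one fun q hq => ?_
    have hqp : q ≠ p := by
      rintro rfl
      exact (Finset.mem_sdiff.1 (hA hq)).2 hp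
    rw [(hP p hp).1.factorization, Finsupp.single_apply, if_neg (Ne.symm hqp), pow_zero]
  have hsum : ∑ i ∈ Finset.Icc 1 k, sg A i = T + P.card := by
    rw [← Finset.sum_sdiff hPsub, ← hTdef, Finset.sum_congr rfl hsgP]
    simp
  have hTQ : |T| ≤ (P.card : ℤ) := by
    apply abs_le_of_sq_le_sq _ (by positivity)
    refine hT.trans ?_
    exact_mod_cast hcount.trans hQ
  rw [abs_le] at hTQ
  refine flip_seed k (sg A) (fun n _ => sg_pm A n) (fun i j hi hj => sg_mul A hi hj) P
    (fun p hp => ⟨(hP p hp).1, (hP p hp).2.1, (hP p hp).2.2, hsgP p hp⟩) ?_ ?_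
  · rw [hsum]; omega
  · rw [hsum]; omega

/-! ### Small `k`, via the character modulo 3 -/

/-- The nontrivial character modulo 3. -/
def c3 (n : ℕ) : ℤ := if n % 3 = 1 then 1 else if n % 3 = 2 then -1 else 0

/-- The character modulo 3, made nonzero by the value `1` at `3`. -/
def f3 (n : ℕ) : ℤ := c3 (ordCompl[3] n)

theorem c3_mul (m n : ℕ) : c3 (m * n) = c3 m * c3 n := by
  unfold c3
  rw [Nat.mul_mod]
  have hm : m % 3 < 3 := Nat.mod_lt _ (by norm_num)
  have hn : n % 3 < 3 := Nat.mod_lt _ (by norm_num)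
  interval_cases m % 3 <;> interval_cases n % 3 <;> simp

theorem f3_mul (m n : ℕ) : f3 (m * n) = f3 m * f3 n := by
  unfold f3
  rw [Nat.ordCompl_mul, c3_mul]

theorem f3_of_not_dvd (n : ℕ) (h : ¬ 3 ∣ n) : f3 n = c3 n := by
  unfold f3
  rw [Nat.factorization_eq_zero_of_not_dvd h, pow_zero, Nat.div_one]

theorem f3_three (n : ℕ) : f3 (3 * n) = f3 n := by
  rw [f3_mul]
  have : f3 3 = 1 := by
    unfold f3
    rw [Nat.Prime.factorization_self Nat.prime_three]
    simp [c3]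
  rw [this, one_mul]

theorem f3_pm (n : ℕ) (hn : 1 ≤ n) : f3 n = 1 ∨ f3 n = -1 := by
  have h := Nat.not_dvd_ordCompl Nat.prime_three (n := n) (by omega)
  unfold f3 c3
  split_ifs
  · simp
  · simp
  · omega

/-- Partial sums of `f3`. -/
def F3 (k : ℕ) : ℤ := ∑ i ∈ Finset.Icc 1 k, f3 i

theorem F3_succ (k : ℕ) : F3 (k + 1) = F3 k + f3 (k + 1) := by
  unfold F3
  rw [Finset.sum_Icc_succ_top (by omega)]

theorem f3_one (q : ℕ) : f3 (3 * q + 1) = 1 := by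
  rw [f3_of_not_dvd _ (by omega)]
  unfold c3
  rw [if_pos (by omega)]

theorem f3_two (q : ℕ) : f3 (3 * q + 2) = -1 := by
  rw [f3_of_not_dvd _ (by omega)]
  unfold c3
  rw [if_neg (by omega), if_pos (by omega)]

theorem F3_zero_mod (q : ℕ) : F3 (3 * q) = F3 q := by
  induction q with
  | zero => simp
  | succ q ih =>
    rw [show 3 * (q + 1) = 3 * q + 1 + 1 + 1 by ring, F3_succ, F3_succ, F3_succ, F3_succ, f3_one,
      f3_two, ih, show 3 * q + 1 + 1 + 1 = 3 * (q + 1) by ring, f3_three]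
    ring

theorem F3_one_mod (q : ℕ) : F3 (3 * q + 1) = F3 q + 1 := by
  rw [F3_succ, F3_zero_mod, f3_one]

theorem F3_two_mod (q : ℕ) : F3 (3 * q + 2) = F3 q := by
  rw [F3_succ, F3_one_mod, f3_two]
  ring

theorem F3_bound (d k : ℕ) (hk : k < 3 ^ d) : 0 ≤ F3 k ∧ F3 k ≤ d := by
  induction d generalizing k with
  | zero =>
    have : k = 0 := by simpa using hk
    subst this
    simp [F3]
  | succ d ih =>
    rw [pow_succ] at hk
    have := ih (k / 3) (by omega)
    have h3 : k % 3 = 0 ∨ k % 3 = 1 ∨ k % 3 = 2 := by omega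
    push_cast
    rcases h3 with h | h | h
    · rw [show k = 3 * (k / 3) by omega, F3_zero_mod]; omega
    · rw [show k = 3 * (k / 3) + 1 by omega, F3_one_mod]; omega
    · rw [show k = 3 * (k / 3) + 2 by omega, F3_two_mod]; omega

/-- Goal proposition. -/
def Golden (k : ℕ) : Prop :=
    ∃ s : ℕ → ℤ,
      (∀ i : ℕ, 1 ≤ i → i ≤ k → s i = 1 ∨ s i = -1) ∧
      (∀ i j : ℕ, 1 ≤ i → 1 ≤ j → i * j ≤ k → s (i * j) = s i * s j) ∧
      |∑ i ∈ Finset.Icc 1 k, s i| ≤ 1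

theorem block (k : ℕ) (P : Finset ℕ) (hP : ∀ p ∈ P, p.Prime ∧ p % 3 = 1)
    (hk : ∀ p ∈ P, p ≤ k ∧ k < 2 * p) (hF : 0 ≤ F3 k ∧ F3 k ≤ 2 * (P.card : ℤ) + 1) :
    Golden k := by
  refine flip_seed k f3 f3_pm (fun i j _ _ => f3_mul i j) P (fun p hp => ?_) hF.1 hF.2
  refine ⟨(hP p hp).1, (hk p hp).1, (hk p hp).2, ?_⟩
  have := (hP p hp).2
  rw [show p = 3 * (p / 3) + 1 by omega, f3_one]

theorem block' (k : ℕ) (P : Finset ℕ) (hP : ∀ p ∈ P, p.Prime ∧ p % 3 = 1)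
    (hk : ∀ p ∈ P, p ≤ k ∧ k < 2 * p) (hF : k < 3 ^ (2 * P.card + 1)) : Golden k := by
  refine block k P hP hk ?_
  have := F3_bound _ _ hF
  push_cast at this
  exact this

theorem tiny_case (k : ℕ) (hk : 2 ≤ k) (hk' : k < 7) : Golden k := by
  refine ⟨fun n => if n = 1 ∨ n = 4 ∨ n = 6 then 1 else -1, ?_, ?_, ?_⟩
  · intro i _ _
    dsimp only
    split_ifs <;> simp
  · intro i j hi hj hij
    have h1 : i ≤ 6 := by nlinarith
    have h2 : j ≤ 6 := by nlinarith
    interval_cases i <;> interval_cases j <;> first | omega | simp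
  · interval_cases k <;> decide

theorem mid_case (k : ℕ) (hk : 27 ≤ k) (hk' : k < 31) : Golden k := by
  refine block k {19} (by norm_num) (by simp; omega) ?_
  refine ⟨(F3_bound 4 k (by omega)).1, ?_⟩
  have h9 := F3_bound 1 (k / 9 / 3) (by omega)
  have e1 : F3 3 = F3 1 := F3_zero_mod 1
  have e2 : F3 9 = F3 3 := F3_zero_mod 3
  have e3 : F3 10 = F3 3 + 1 := F3_one_mod 3
  have e4 : F3 1 = F3 0 + 1 := F3_one_mod 0
  have e5 : F3 0 = 0 := by simp [F3]
  have e6 : F3 27 = F3 9 := F3_zero_mod 9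
  have e7 : F3 28 = F3 9 + 1 := F3_one_mod 9
  have e8 : F3 29 = F3 9 := F3_two_mod 9
  have e9 : F3 30 = F3 10 := F3_zero_mod 10
  rw [Finset.card_singleton]
  interval_cases k <;> omega

theorem small_case (k : ℕ) (hk : 2 ≤ k) (hk' : k < 131072) : Golden k := by
  by_cases h : k < 7
  · exact tiny_case k hk h
  by_cases h1 : k < 14
  · exact block' k {7} (by norm_num) (by simp; omega) (by simp; omega)
  by_cases h2 : k < 26
  · exact block' k {13} (by norm_num) (by simp; omega) (by simp; omega)
  by_cases h3 : k < 27
  · exact block' k {19} (by norm_num) (by simp; omega) (by simp; omega)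
  by_cases h4 : k < 31
  · exact mid_case k (by omega) h4
  by_cases g31 : k < 38
  · exact block' k {19, 31} (by norm_num) (by simp; omega) (by simp; omega)
  by_cases g38 : k < 62
  · exact block' k {31, 37} (by norm_num) (by simp; omega) (by simp; omega)
  by_cases g62 : k < 86
  · exact block' k {43, 61} (by norm_num) (by simp; omega) (by simp; omega)
  by_cases g86 : k < 146
  · exact block' k {73, 79} (by norm_num) (by simp; omega) (by simp; omega)
  by_cases g146 : k < 243
  · exact block' k {127, 139} (by norm_num) (by simp; omega) (by simp; omega)
  by_cases g243 : k < 446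
  · exact block' k {223, 229, 241} (by norm_num) (by simp; omega) (by simp; omega)
  by_cases g446 : k < 842
  · exact block' k {421, 433, 439} (by norm_num) (by simp; omega) (by simp; omega)
  by_cases g842 : k < 1622
  · exact block' k {811, 823, 829} (by norm_num) (by simp; omega) (by simp; omega)
  by_cases g1622 : k < 2187
  · exact block' k {1597, 1609, 1621} (by norm_num) (by simp; omega) (by simp; omega)
  by_cases g2187 : k < 4274
  · exact block' k {2137, 2143, 2161, 2179} (by norm_num) (by simp; omega) (by simp; omega)
  by_cases g4274 : k < 8462
  · exact block' k {4231, 4243, 4261, 4273} (by norm_num) (by simp; omega) (by simp; omega)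
  by_cases g8462 : k < 16838
  · exact block' k {8419, 8431, 8443, 8461} (by norm_num) (by simp; omega) (by simp; omega)
  by_cases g16838 : k < 19683
  · exact block' k {16741, 16747, 16759, 16831} (by norm_num) (by simp; omega) (by simp; omega)
  by_cases g19683 : k < 39086
  · exact block' k {19543, 19597, 19603, 19609, 19681} (by norm_num) (by simp; omega) (by simp; omega)
  by_cases g39086 : k < 77942
  · exact block' k {38971, 38977, 39019, 39043, 39079} (by norm_num) (by simp; omega) (by simp; omega)
  by_cases g77942 : k < 155678
  · exact block' k {77839, 77863, 77893, 77899, 77929} (by norm_num) (by simp; omega) (by simp; omega)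
  omega

/-- **Golden seeds exist**: for every `k ≥ 2` there is a string
`s : {1,…,k} → {-1,+1}` that is multiplicative within range
(`s(ij) = s(i)s(j)` whenever `ij ≤ k`) and balanced (`|∑_{i=1}^k s(i)| ≤ 1`). -/
theorem golden_seed_exists (k : ℕ) (hk : 2 ≤ k) :
    ∃ s : ℕ → ℤ,
      (∀ i : ℕ, 1 ≤ i → i ≤ k → s i = 1 ∨ s i = -1) ∧
      (∀ i j : ℕ, 1 ≤ i → 1 ≤ j → i * j ≤ k → s (i * j) = s i * s j) ∧
      |∑ i ∈ Finset.Icc 1 k, s i| ≤ 1 := by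
  by_cases h : k < 131072
  · exact small_case k hk h
  · exact large_case k (by omega)
end

section
/- For every k ≥ 2 there exists a 2-coloring f : ℕ⁺ → {−1,+1} such that for every d ≥ 1, |∑_{i=1}^{k} f(i·d)| ≤ 1, i.e., every cascade of length k is balanced. -/
open Finset

/-- The completely multiplicative extension of the character mod 3, with value `1` at `3`. -/
def bh (n : ℕ) : ℤ := if (n / 3 ^ n.factorization 3) % 3 = 1 then 1 else -1

lemma bh_sq (n : ℕ) : bh n = 1 ∨ bh n = -1 := by
  unfold bh; split_ifs <;> simp

lemma ordc_mod (n : ℕ) (hn : n ≠ 0) :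
    (n / 3 ^ n.factorization 3) % 3 = 1 ∨ (n / 3 ^ n.factorization 3) % 3 = 2 := by
  have := Nat.not_dvd_ordCompl Nat.prime_three hn
  omega

lemma bh_mul (a b : ℕ) (ha : a ≠ 0) (hb : b ≠ 0) : bh (a * b) = bh a * bh b := by
  unfold bh
  rw [Nat.ordCompl_mul a b 3, Nat.mul_mod]
  rcases ordc_mod a ha with h1 | h1 <;> rcases ordc_mod b hb with h2 | h2 <;> simp [h1, h2]

lemma bh_of_not_dvd (n : ℕ) (hn : ¬ 3 ∣ n) : bh n = if n % 3 = 1 then 1 else -1 := by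
  unfold bh
  rw [Nat.factorization_eq_zero_of_not_dvd hn]
  simp

lemma bh_three : bh 3 = 1 := by
  unfold bh
  simp [Nat.prime_three.factorization]

/-- Partial sums. -/
def bS (j : ℕ) : ℤ := ∑ i ∈ Icc 1 j, bh i

lemma bS_zero : bS 0 = 0 := by simp [bS]

lemma bS_succ (j : ℕ) : bS (j + 1) = bS j + bh (j + 1) := by
  unfold bS
  rw [Finset.sum_Icc_succ_top (by omega)]

lemma bS_three_mul (q : ℕ) : bS (3 * q) = bS q := by
  induction q with
  | zero => rfl
  | succ q ih =>
    rw [show 3 * (q + 1) = 3 * q + 1 + 1 + 1 by ring, bS_succ, bS_succ, bS_succ, bS_succ, ih,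
      bh_of_not_dvd (3 * q + 1) (by omega), bh_of_not_dvd (3 * q + 1 + 1) (by omega),
      show 3 * q + 1 + 1 + 1 = 3 * (q + 1) by ring, bh_mul 3 (q+1) (by omega) (by omega), bh_three]
    have h1 : (3 * q + 1) % 3 = 1 := by omega
    have h2 : (3 * q + 1 + 1) % 3 = 2 := by omega
    simp [h1, h2]

lemma bS_rec (j : ℕ) : bS j = bS (j / 3) + if j % 3 = 1 then 1 else 0 := by
  obtain ⟨q, r, hr, rfl⟩ : ∃ q r, r < 3 ∧ j = 3 * q + r :=
    ⟨j / 3, j % 3, by omega, by omega⟩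
  have hq : (3 * q + r) / 3 = q := by omega
  have hm : (3 * q + r) % 3 = r := by omega
  rw [hq, hm]
  interval_cases r
  · simp [bS_three_mul]
  · rw [bS_succ, bS_three_mul, bh_of_not_dvd _ (by omega)]
    simp
  · rw [show 3 * q + 2 = 3 * q + 1 + 1 by ring, bS_succ, bS_succ, bS_three_mul,
      bh_of_not_dvd _ (by omega), bh_of_not_dvd _ (by omega)]
    have h1 : (3 * q + 1) % 3 = 1 := by omega
    have h2 : (3 * q + 1 + 1) % 3 = 2 := by omega
    simp [h1, h2]

lemma bS_bound (L : ℕ) : ∀ j, j < 3 ^ L → 0 ≤ bS j ∧ bS j ≤ L := by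
  induction L with
  | zero => intro j hj; have : j = 0 := by simpa using hj
            subst this; simp [bS_zero]
  | succ L ih =>
    intro j hj
    rw [bS_rec]
    have := ih (j / 3) (by rw [pow_succ] at hj; omega)
    split_ifs <;> push_cast <;> omega

/-- The flipped function. -/
def bf (Q : Finset ℕ) (n : ℕ) : ℤ := bh n * ∏ q ∈ Q, (-1) ^ n.factorization q

lemma bf_sq (Q : Finset ℕ) (n : ℕ) : bf Q n = 1 ∨ bf Q n = -1 := by
  unfold bf
  have : (∏ q ∈ Q, (-1 : ℤ) ^ n.factorization q) = 1 ∨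
      (∏ q ∈ Q, (-1 : ℤ) ^ n.factorization q) = -1 := by
    rw [Finset.prod_pow_eq_pow_sum]
    exact neg_one_pow_eq_or ℤ _
  rcases this with h | h <;> rcases bh_sq n with h' | h' <;> simp [h, h']

lemma bf_mul (Q : Finset ℕ) (a b : ℕ) (ha : a ≠ 0) (hb : b ≠ 0) :
    bf Q (a * b) = bf Q a * bf Q b := by
  unfold bf
  rw [bh_mul a b ha hb, Nat.factorization_mul ha hb]
  simp only [Finsupp.add_apply, pow_add, Finset.prod_mul_distrib]
  ring

lemma bprod (k : ℕ) (Q : Finset ℕ) (hQ : ∀ q ∈ Q, q.Prime ∧ k < q ^ 2) (n : ℕ)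
    (hn : 1 ≤ n) (hnk : n ≤ k) :
    (∏ q ∈ Q, (-1 : ℤ) ^ n.factorization q) = 1 - 2 * ∑ q ∈ Q, if q ∣ n then 1 else 0 := by
  by_cases h : ∃ p ∈ Q, p ∣ n
  · obtain ⟨p, hp, hpn⟩ := h
    have huniq : ∀ q ∈ Q, q ≠ p → ¬ q ∣ n := by
      intro q hq hne hqn
      have hc : Nat.Coprime q p := (Nat.coprime_primes (hQ q hq).1 (hQ p hp).1).2 hne
      have := Nat.le_of_dvd (by omega) (hc.mul_dvd_of_dvd_of_dvd hqn hpn)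
      have h1 := (hQ q hq).2
      have h2 := (hQ p hp).2
      rcases le_total q p with h | h <;> nlinarith
    have hv : n.factorization p = 1 := by
      have h1 : 1 ≤ n.factorization p := ((hQ p hp).1.dvd_iff_one_le_factorization (by omega)).1 hpn
      have h2 : ¬ 2 ≤ n.factorization p := by
        intro h2
        have := ((hQ p hp).1.pow_dvd_iff_le_factorization (by omega)).2 h2
        have := Nat.le_of_dvd (by omega) this
        have := (hQ p hp).2
        omega
      omega
    rw [Finset.prod_eq_single p, Finset.sum_eq_single p]
    · simp [hv, hpn]
    · intro q hq hne; simp [huniq q hq hne]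
    · intro h; exact absurd hp h
    · intro q hq hne; simp [Nat.factorization_eq_zero_of_not_dvd (huniq q hq hne)]
    · intro h; exact absurd hp h
  · push Not at h
    rw [Finset.prod_eq_one, Finset.sum_eq_zero]
    · simp
    · intro q hq; simp [h q hq]
    · intro q hq; simp [Nat.factorization_eq_zero_of_not_dvd (h q hq)]

lemma sum_mult {M : Type*} [AddCommMonoid M] (k q : ℕ) (hq : 1 ≤ q) (g : ℕ → M) :
    (∑ n ∈ Icc 1 k, if q ∣ n then g n else 0) = ∑ m ∈ Icc 1 (k / q), g (q * m) := by
  rw [← Finset.sum_filter]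
  symm
  refine Finset.sum_bij (fun m _ => q * m) ?_ ?_ ?_ ?_
  · intro m hm
    simp only [mem_Icc, mem_filter] at *
    refine ⟨⟨?_, ?_⟩, Dvd.intro _ rfl⟩
    · exact Nat.mul_pos (by omega) (by omega)
    · calc q * m ≤ q * (k / q) := Nat.mul_le_mul_left _ hm.2
        _ ≤ k := Nat.mul_div_le k q
  · intro a _ b _ h
    exact Nat.eq_of_mul_eq_mul_left (by omega) h
  · intro n hn
    simp only [mem_Icc, mem_filter] at hn
    obtain ⟨⟨h1, h2⟩, m, rfl⟩ := hn
    refine ⟨m, ?_, rfl⟩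
    simp only [mem_Icc]
    refine ⟨Nat.pos_of_ne_zero (by rintro rfl; simp at h1), ?_⟩
    rw [Nat.le_div_iff_mul_le (by omega)]; linarith
  · intros; rfl

lemma bh_sum_mult (k q : ℕ) (hq : 1 ≤ q) :
    (∑ n ∈ Icc 1 k, if q ∣ n then bh n else 0) = bh q * bS (k / q) := by
  rw [sum_mult k q hq, bS, Finset.mul_sum]
  refine Finset.sum_congr rfl fun m hm => ?_
  simp only [mem_Icc] at hm
  exact bh_mul _ _ (by omega) (by omega)

lemma bf_sum (k : ℕ) (Q : Finset ℕ) (hQ : ∀ q ∈ Q, q.Prime ∧ k < q ^ 2) :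
    ∑ n ∈ Icc 1 k, bf Q n = bS k - 2 * ∑ q ∈ Q, bh q * bS (k / q) := by
  have h1 : ∀ n ∈ Icc 1 k, bf Q n = bh n - 2 * ∑ q ∈ Q, if q ∣ n then bh n else 0 := by
    intro n hn
    simp only [mem_Icc] at hn
    unfold bf
    rw [bprod k Q hQ n hn.1 hn.2, mul_sub, mul_one]
    congr 1
    rw [mul_left_comm, Finset.mul_sum]
    congr 1
    refine Finset.sum_congr rfl fun q _ => ?_
    split_ifs <;> simp
  rw [Finset.sum_congr rfl h1, Finset.sum_sub_distrib, ← Finset.mul_sum, Finset.sum_comm]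
  congr 2
  refine Finset.sum_congr rfl fun q hq => bh_sum_mult k q (hQ q hq).1.one_lt.le

/-- The conclusion for a given `k`. -/
def BGood (k : ℕ) : Prop := ∃ f : ℕ → ℤ,
      (∀ n : ℕ, 1 ≤ n → f n = 1 ∨ f n = -1) ∧
      ∀ d : ℕ, 1 ≤ d → |∑ i ∈ Finset.Icc 1 k, f (i * d)| ≤ 1

lemma good_of_flip (k : ℕ) (Q : Finset ℕ) (hQ : ∀ q ∈ Q, q.Prime ∧ k < q ^ 2)
    (h : |bS k - 2 * ∑ q ∈ Q, bh q * bS (k / q)| ≤ 1) : BGood k := by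
  refine ⟨bf Q, fun n _ => bf_sq Q n, fun d hd => ?_⟩
  have : ∑ i ∈ Finset.Icc 1 k, bf Q (i * d) = (∑ i ∈ Finset.Icc 1 k, bf Q i) * bf Q d := by
    rw [Finset.sum_mul]
    refine Finset.sum_congr rfl fun i hi => ?_
    simp only [mem_Icc] at hi
    exact bf_mul _ _ _ (by omega) (by omega)
  rw [this, bf_sum k Q hQ, abs_mul]
  rcases bf_sq Q d with h' | h' <;> simpa [h'] using h

lemma bS_one : bS 1 = 1 := by rw [bS_rec]; simp [bS_zero]

lemma upper_half {k q : ℕ} (h1 : k / 2 < q) (h2 : q ≤ k) : k / q = 1 := by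
  rw [Nat.div_eq_iff (by omega)]; omega

lemma upper_half_sq {k q : ℕ} (_hk : 2 ≤ k) (hp : q.Prime) (h1 : k / 2 < q) : k < q ^ 2 := by
  have := hp.two_le
  nlinarith [Nat.div_add_mod k 2, Nat.mod_lt k two_pos]

/-- Enough primes with `bh = 1` in the upper half. -/
lemma good_caseA (k : ℕ) (hk : 2 ≤ k) (P : Finset ℕ)
    (hP : ∀ q ∈ P, q.Prime ∧ k / 2 < q ∧ q ≤ k ∧ bh q = 1) (hc : bS k ≤ 2 * (P.card : ℤ) + 1) :
    BGood k := by
  have hS0 := (bS_bound k k (Nat.lt_pow_self (by norm_num))).1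
  obtain ⟨Q, hQP, hQ⟩ := Finset.exists_subset_card_eq (s := P) (n := (bS k / 2).toNat) (by omega)
  refine good_of_flip k Q (fun q hq => ⟨(hP q (hQP hq)).1, ?_⟩) ?_
  · exact upper_half_sq hk (hP q (hQP hq)).1 (hP q (hQP hq)).2.1
  · have : ∑ q ∈ Q, bh q * bS (k / q) = ∑ q ∈ Q, 1 := by
      refine Finset.sum_congr rfl fun q hq => ?_
      obtain ⟨_, h1, h2, h3⟩ := hP q (hQP hq)
      rw [upper_half h1 h2, bS_one, h3, one_mul]
    rw [this]
    simp only [sum_const, hQ, nsmul_eq_mul, mul_one]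
    rw [abs_le]; omega

lemma pick_subset (w : ℕ → ℤ) (L s : ℤ) (hs : 0 ≤ s) (hL : 0 ≤ L) (A : Finset ℕ) :
    (∀ a ∈ A, 0 ≤ w a ∧ w a ≤ L) → s ≤ 2 * ∑ a ∈ A, w a →
    ∃ B ⊆ A, s ≤ 2 * ∑ a ∈ B, w a ∧ 2 * ∑ a ∈ B, w a ≤ s + 2 * L := by
  induction A using Finset.induction_on with
  | empty => intro _ h; exact ⟨∅, by simp, h, by simp at *; omega⟩
  | insert a A ha ih =>
    intro hw h
    by_cases h' : s ≤ 2 * ∑ a ∈ A, w a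
    · obtain ⟨B, hB, h1, h2⟩ := ih (fun b hb => hw b (mem_insert_of_mem hb)) h'
      exact ⟨B, hB.trans (subset_insert _ _), h1, h2⟩
    · refine ⟨insert a A, le_rfl, h, ?_⟩
      rw [sum_insert ha]
      have := hw a (mem_insert_self _ _)
      omega

lemma good_caseB (k L : ℕ) (hk : 2 ≤ k) (hL : k < 3 ^ L) (A P : Finset ℕ)
    (hA : ∀ q ∈ A, q.Prime ∧ k < q ^ 2 ∧ bh q = 1)
    (hV : (L : ℤ) ≤ 2 * ∑ q ∈ A, bS (k / q))
    (hP : ∀ q ∈ P, q.Prime ∧ k / 2 < q ∧ q ≤ k ∧ bh q = -1) (hc : L ≤ P.card) :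
    BGood k := by
  have hS := bS_bound L k hL
  obtain ⟨B, hBA, h1, h2⟩ := pick_subset (fun q => bS (k / q)) L (bS k) hS.1 (by omega) A
    (fun a _ => bS_bound L _ ((Nat.div_le_self _ _).trans_lt hL)) (by omega)
  obtain ⟨Q, hQP, hQ⟩ := Finset.exists_subset_card_eq (s := P)
    (n := ((2 * ∑ a ∈ B, bS (k / a) - bS k) / 2).toNat) (by omega)
  have hd : Disjoint B Q := by
    rw [Finset.disjoint_left]
    intro a ha hb
    have e1 := (hA a (hBA ha)).2.2
    have e2 := (hP a (hQP hb)).2.2.2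
    omega
  refine good_of_flip k (B ∪ Q) ?_ ?_
  · intro q hq
    rcases Finset.mem_union.1 hq with h | h
    · exact ⟨(hA q (hBA h)).1, (hA q (hBA h)).2.1⟩
    · exact ⟨(hP q (hQP h)).1, upper_half_sq hk (hP q (hQP h)).1 (hP q (hQP h)).2.1⟩
  · rw [Finset.sum_union hd]
    have e1 : ∑ q ∈ B, bh q * bS (k / q) = ∑ q ∈ B, bS (k / q) :=
      Finset.sum_congr rfl fun q hq => by rw [(hA q (hBA hq)).2.2, one_mul]
    have e2 : ∑ q ∈ Q, bh q * bS (k / q) = ∑ q ∈ Q, -1 := by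
      refine Finset.sum_congr rfl fun q hq => ?_
      obtain ⟨_, h1, h2, h3⟩ := hP q (hQP hq)
      rw [upper_half h1 h2, bS_one, h3, mul_one]
    rw [e1, e2]
    simp only [sum_const, hQ, nsmul_eq_mul]
    rw [abs_le]; omega

lemma many_primes (n : ℕ) (hn : 4 ≤ n) :
    4 ^ n < n * ((2 * n) ^ Nat.sqrt (2 * n) * 4 ^ (2 * n / 3) *
      (2 * n) ^ ((Ioc n (2 * n)).filter Nat.Prime).card) := by
  refine (Nat.four_pow_lt_mul_centralBinom n hn).trans_le (Nat.mul_le_mul_left _ ?_)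
  have n_pos : 0 < n := by omega
  have n2_pos : 1 ≤ 2 * n := by omega
  set f : ℕ → ℕ := fun x => x ^ n.centralBinom.factorization x with hf
  have hle : ∀ p, f p ≤ 2 * n := fun p => Nat.pow_factorization_choose_le (by omega)
  set T := (Finset.range (2 * n + 1)).filter Nat.Prime with hT
  have hprod : n.centralBinom = ∏ p ∈ T, f p := by
    rw [← Nat.prod_pow_factorization_centralBinom n]
    symm
    refine Finset.prod_filter_of_ne fun p _ h => ?_
    contrapose h
    simp only [hf]; rw [Nat.factorization_eq_zero_of_not_prime n.centralBinom h, _root_.pow_zero]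
  rw [hprod, ← Finset.prod_filter_mul_prod_filter_not T (· ≤ n)]
  apply Nat.mul_le_mul
  · rw [← Finset.prod_filter_mul_prod_filter_not (T.filter (· ≤ n)) (· ≤ Nat.sqrt (2 * n))]
    apply Nat.mul_le_mul
    · refine (Finset.prod_le_prod' fun p _ => hle p).trans ?_
      have : (Finset.Icc 1 (Nat.sqrt (2 * n))).card = Nat.sqrt (2 * n) := by simp
      rw [Finset.prod_const]
      refine pow_right_mono₀ n2_pos ((Finset.card_le_card fun x hx => ?_).trans this.le)
      simp only [hT, mem_filter] at hx
      exact Finset.mem_Icc.mpr ⟨hx.1.1.2.one_lt.le, hx.2⟩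
    · refine le_trans ?_ (primorial_le_four_pow (2 * n / 3))
      unfold primorial
      have h1 : ∀ p ∈ {x ∈ T.filter (· ≤ n) | ¬ x ≤ Nat.sqrt (2 * n)}, f p ≤
          if p ≤ 2 * n / 3 then p else 1 := by
        intro p hp
        simp only [hT, mem_filter] at hp
        split_ifs with h
        · refine (pow_right_mono₀ hp.1.1.2.one_lt.le ?_).trans (pow_one p).le
          exact Nat.factorization_choose_le_one (Nat.sqrt_lt'.mp <| not_le.1 hp.2)
        · rw [hf]
          simp only
          rw [Nat.factorization_centralBinom_of_two_mul_self_lt_three_mul (by omega) hp.1.2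
            (by omega), pow_zero]
      refine (Finset.prod_le_prod' h1).trans ?_
      rw [← Finset.prod_filter]
      refine Finset.prod_le_prod_of_subset_of_one_le' ?_ ?_
      · intro p hp
        simp only [hT, mem_filter, mem_range] at hp ⊢
        exact ⟨by omega, hp.1.1.1.2⟩
      · intro p hp _
        exact (Finset.mem_filter.1 hp).2.one_lt.le
  · refine (Finset.prod_le_prod' fun p _ => hle p).trans ?_
    rw [Finset.prod_const]
    refine pow_right_mono₀ n2_pos (Finset.card_le_card fun x hx => ?_)
    simp only [hT, mem_filter, mem_range, mem_Ioc] at hx ⊢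
    exact ⟨by omega, hx.1.2⟩

lemma many_primes' (n m : ℕ) (hn : 4 ≤ n) (hm : 2 * n ≤ 2 ^ m) :
    2 * n ≤ 3 * m * (((Ioc n (2 * n)).filter Nat.Prime).card + Nat.sqrt (2 * n) + 1) := by
  set N := ((Ioc n (2 * n)).filter Nat.Prime).card
  set s := Nat.sqrt (2 * n)
  have h := many_primes n hn
  have h2 : n * ((2 * n) ^ s * 4 ^ (2 * n / 3) * (2 * n) ^ N) ≤
      2 ^ m * ((2 ^ m) ^ s * 4 ^ (2 * n / 3) * (2 ^ m) ^ N) := by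
    gcongr; omega
  have h3 : (2:ℕ) ^ (2 * n) < 2 ^ (m + (m * s + 2 * (2 * n / 3) + m * N)) := by
    calc (2:ℕ) ^ (2 * n) = 4 ^ n := by rw [pow_mul]; norm_num
      _ < _ := h
      _ ≤ _ := h2
      _ = _ := by
        rw [show (4:ℕ) = 2 ^ 2 by norm_num]
        simp only [← pow_mul, ← pow_add]
  have h4 := (Nat.pow_lt_pow_iff_right (by norm_num)).1 h3
  have h5 : 3 * m * (N + s + 1) = 3 * (m + m * s + m * N) := by ring
  rw [h5]
  omega

open ArithmeticFunction in
lemma log_identity (k : ℕ) :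
    ∑ n ∈ Icc 1 k, (bh n : ℝ) * Real.log n =
      ∑ d ∈ Icc 1 k, vonMangoldt d * ((bh d * bS (k / d) : ℤ) : ℝ) := by
  have h1 : ∀ n ∈ Icc 1 k, (bh n : ℝ) * Real.log n =
      ∑ d ∈ Icc 1 k, if d ∣ n then vonMangoldt d * (bh n : ℝ) else 0 := by
    intro n hn
    simp only [mem_Icc] at hn
    rw [← vonMangoldt_sum, Finset.mul_sum, ← Finset.sum_filter]
    refine (Finset.sum_congr ?_ fun d _ => mul_comm _ _)
    ext d
    simp only [Nat.mem_divisors, mem_filter, mem_Icc]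
    constructor
    · rintro ⟨h, h0⟩
      exact ⟨⟨Nat.pos_of_dvd_of_pos h (by omega), (Nat.le_of_dvd (by omega) h).trans hn.2⟩, h⟩
    · rintro ⟨_, h⟩
      exact ⟨h, by omega⟩
  rw [Finset.sum_congr rfl h1, Finset.sum_comm]
  refine Finset.sum_congr rfl fun d hd => ?_
  simp only [mem_Icc] at hd
  rw [← bh_sum_mult k d hd.1]
  push_cast
  rw [Finset.mul_sum]
  refine Finset.sum_congr rfl fun n _ => ?_
  split_ifs <;> simp

lemma abel_lower (k L : ℕ) (hL : k < 3 ^ L) (j : ℕ) (hj : 1 ≤ j) : j ≤ k →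
    ((bS j : ℝ) - L) * Real.log j ≤ ∑ n ∈ Icc 1 j, (bh n : ℝ) * Real.log n := by
  induction j, hj using Nat.le_induction with
  | base => intro _; simp
  | succ j hj ih =>
    intro hjk
    have ih := ih (by omega)
    rw [Finset.sum_Icc_succ_top (by omega), bS_succ]
    have h1 : (bS j : ℝ) ≤ L := by
      exact_mod_cast (bS_bound L j (by omega)).2
    have h2 : Real.log j ≤ Real.log ((j + 1 : ℕ) : ℝ) := by
      apply Real.log_le_log
      · exact_mod_cast hj
      · push_cast; linarith
    push_cast at *
    nlinarith

open ArithmeticFunction in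
lemma bad_sum (k : ℕ) (hk : 1 ≤ k) :
    ∑ d ∈ (Icc 1 k).filter (fun d => ¬ (d.Prime ∧ Nat.sqrt k < d)), vonMangoldt d ≤
      Nat.sqrt k * Real.log k := by
  have hpsi : ∑ d ∈ Icc 1 k, vonMangoldt d = ∑ p ∈ Nat.primesLE k, p.log k * Real.log p := by
    rw [← Chebyshev.psi_eq_sum_mul_log_prime, Chebyshev.psi_eq_sum_Icc]
    simp only [Nat.floor_natCast]
    symm
    refine Finset.sum_subset_zero_on_sdiff (s₂ := Icc 0 k) (s₁ := Icc 1 k) ?_ ?_ ?_ |>.symm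
    · intro x; simp; 
    · intro x hx
      have : x = 0 := by simp at hx; omega
      simp [this]
    · intros; rfl
  have hsplit := Finset.sum_filter_add_sum_filter_not (Icc 1 k)
    (fun d => (d.Prime ∧ Nat.sqrt k < d)) (fun d => (vonMangoldt d : ℝ))
  have hsplit2 := Finset.sum_filter_add_sum_filter_not (Nat.primesLE k)
    (fun d => (Nat.sqrt k < d)) (fun p => (p.log k * Real.log p : ℝ))
  have heq : ∑ d ∈ (Icc 1 k).filter (fun d => (d.Prime ∧ Nat.sqrt k < d)), vonMangoldt d =
      ∑ p ∈ (Nat.primesLE k).filter (fun d => (Nat.sqrt k < d)), (p.log k * Real.log p : ℝ) := by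
    refine Finset.sum_congr ?_ ?_
    · ext p
      simp only [mem_filter, mem_Icc, Nat.mem_primesLE]
      constructor
      · rintro ⟨⟨_, h⟩, hp, h'⟩; exact ⟨⟨h, hp⟩, h'⟩
      · rintro ⟨⟨h, hp⟩, h'⟩; exact ⟨⟨hp.one_lt.le, h⟩, hp, h'⟩
    · intro p hp
      simp only [mem_filter, Nat.mem_primesLE] at hp
      have : p.log k = 1 := by
        rw [Nat.log_eq_iff (by left; norm_num)]
        refine ⟨by simpa using hp.1.1, ?_⟩
        exact Nat.sqrt_lt'.1 hp.2
      rw [vonMangoldt_apply_prime hp.1.2, this]; simp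
  have hfin : ∑ p ∈ (Nat.primesLE k).filter (fun d => ¬ (Nat.sqrt k < d)),
      (p.log k * Real.log p : ℝ) ≤ Nat.sqrt k * Real.log k := by
    have hb : ∀ p ∈ (Nat.primesLE k).filter (fun d => ¬ (Nat.sqrt k < d)),
      (p.log k * Real.log p : ℝ) ≤ Real.log k := by
      intro p hp
      simp only [mem_filter, Nat.mem_primesLE] at hp
      rw [← Real.log_pow]
      apply Real.log_le_log
      · have := hp.1.2.pos; positivity
      · exact_mod_cast Nat.pow_log_le_self p (by omega)
    refine (Finset.sum_le_card_nsmul _ _ _ hb).trans ?_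
    rw [nsmul_eq_mul]
    gcongr
    calc _ ≤ (Icc 1 (Nat.sqrt k)).card := Finset.card_le_card (by
            intro p hp
            simp only [mem_filter, Nat.mem_primesLE, mem_Icc] at hp ⊢
            exact ⟨hp.1.2.one_lt.le, by omega⟩)
      _ = _ := by simp
  linarith

open ArithmeticFunction in
lemma key_bound (k L : ℕ) (hk : 2 ≤ k) (hL : k < 3 ^ L) :
    ((((Ioc (k / 2) k).filter (fun q => q.Prime ∧ bh q = -1)).card : ℕ) : ℤ) ≤
      2 * ∑ q ∈ (Ioc (Nat.sqrt k) k).filter (fun q => q.Prime ∧ bh q = 1), bS (k / q)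
        + 2 * L * (Nat.sqrt k + 1) := by
  set I := (Ioc (k / 2) k).filter (fun q => q.Prime ∧ bh q = -1) with hI
  set A := (Ioc (Nat.sqrt k) k).filter (fun q => q.Prime ∧ bh q = 1) with hA
  set C := (Ioc (Nat.sqrt k) k).filter (fun q => q.Prime ∧ bh q = -1) with hC
  have hlogk : 0 < Real.log k := Real.log_pos (by exact_mod_cast hk)
  have hSb : ∀ d, 0 ≤ (bS (k / d) : ℝ) ∧ (bS (k / d) : ℝ) ≤ L := by
    intro d
    have := bS_bound L (k / d) ((Nat.div_le_self _ _).trans_lt hL)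
    exact ⟨by exact_mod_cast this.1, by exact_mod_cast this.2⟩
  have h1 := abel_lower k L hL k (by omega) le_rfl
  rw [log_identity, ← Finset.sum_filter_add_sum_filter_not (Icc 1 k)
    (fun d => (d.Prime ∧ Nat.sqrt k < d))] at h1
  have hS0 : 0 ≤ (bS k : ℝ) := by simpa using (hSb 1).1
  -- the bad part
  have hbad : ∑ d ∈ (Icc 1 k).filter (fun d => ¬ (d.Prime ∧ Nat.sqrt k < d)),
      vonMangoldt d * ((bh d * bS (k / d) : ℤ) : ℝ) ≤ L * (Nat.sqrt k * Real.log k) := by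
    refine le_trans ?_ (mul_le_mul_of_nonneg_left (bad_sum k (by omega)) (Nat.cast_nonneg L))
    rw [Finset.mul_sum]
    refine Finset.sum_le_sum fun d _ => ?_
    rw [mul_comm (L : ℝ)]
    refine mul_le_mul_of_nonneg_left ?_ vonMangoldt_nonneg
    have := hSb d
    rcases bh_sq d with h | h <;> rw [h] <;> push_cast <;> linarith
  -- the good part
  have hgood : ∑ d ∈ (Icc 1 k).filter (fun d => (d.Prime ∧ Nat.sqrt k < d)),
      vonMangoldt d * ((bh d * bS (k / d) : ℤ) : ℝ) =
      ∑ q ∈ A, Real.log q * (bS (k / q) : ℝ) - ∑ q ∈ C, Real.log q * (bS (k / q) : ℝ) := by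
    rw [← Finset.sum_filter_add_sum_filter_not _ (fun d => bh d = 1), sub_eq_add_neg,
      ← Finset.sum_neg_distrib]
    congr 1
    · refine Finset.sum_congr ?_ ?_
      · ext q
        simp only [hA, mem_filter, mem_Icc, mem_Ioc]
        constructor
        · rintro ⟨⟨⟨_, a⟩, b, c⟩, d⟩; exact ⟨⟨c, a⟩, b, d⟩
        · rintro ⟨⟨c, a⟩, b, d⟩; exact ⟨⟨⟨b.one_lt.le, a⟩, b, c⟩, d⟩
      · intro q hq
        simp only [hA, mem_filter] at hq
        rw [vonMangoldt_apply_prime hq.2.1, hq.2.2]; simp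
    · refine Finset.sum_congr ?_ ?_
      · ext q
        simp only [hC, mem_filter, mem_Icc, mem_Ioc]
        constructor
        · rintro ⟨⟨⟨_, a⟩, b, c⟩, d⟩; exact ⟨⟨c, a⟩, b, (bh_sq q).resolve_left d⟩
        · rintro ⟨⟨c, a⟩, b, d⟩; exact ⟨⟨⟨b.one_lt.le, a⟩, b, c⟩, by rw [d]; norm_num⟩
      · intro q hq
        simp only [hC, mem_filter] at hq
        rw [vonMangoldt_apply_prime hq.2.1, hq.2.2]; simp
  have hAle : ∑ q ∈ A, Real.log q * (bS (k / q) : ℝ) ≤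
      Real.log k * ∑ q ∈ A, (bS (k / q) : ℝ) := by
    rw [Finset.mul_sum]
    refine Finset.sum_le_sum fun q hq => ?_
    simp only [hA, mem_filter, mem_Ioc] at hq
    refine mul_le_mul_of_nonneg_right ?_ (hSb q).1
    apply Real.log_le_log
    · exact_mod_cast hq.2.1.pos
    · exact_mod_cast hq.1.2
  have hCge : (I.card : ℝ) * (Real.log k / 2) ≤ ∑ q ∈ C, Real.log q * (bS (k / q) : ℝ) := by
    have hIC : I ⊆ C := by
      intro q hq
      simp only [hI, hC, mem_filter, mem_Ioc] at hq ⊢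
      refine ⟨⟨?_, hq.1.2⟩, hq.2⟩
      exact Nat.sqrt_lt'.2 (upper_half_sq hk hq.2.1 hq.1.1)
    calc (I.card : ℝ) * (Real.log k / 2) = ∑ q ∈ I, Real.log k / 2 := by
          rw [sum_const, nsmul_eq_mul]
      _ ≤ ∑ q ∈ I, Real.log q * (bS (k / q) : ℝ) := by
        refine Finset.sum_le_sum fun q hq => ?_
        simp only [hI, mem_filter, mem_Ioc] at hq
        rw [upper_half hq.1.1 hq.1.2, bS_one]
        have h2 : Real.log k ≤ Real.log ((q : ℝ) ^ 2) := by
          apply Real.log_le_log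
          · exact_mod_cast (by omega : 0 < k)
          · exact_mod_cast (upper_half_sq hk hq.2.1 hq.1.1).le
        rw [Real.log_pow] at h2
        push_cast at *
        linarith
      _ ≤ _ := by
        refine Finset.sum_le_sum_of_subset_of_nonneg hIC fun q hq _ => ?_
        exact mul_nonneg (Real.log_natCast_nonneg q) (hSb q).1
  rw [hgood] at h1
  have hfinal : Real.log k * (I.card : ℝ) ≤ Real.log k *
      (2 * ∑ q ∈ A, (bS (k / q) : ℝ) + 2 * L * (Nat.sqrt k + 1)) := by
    nlinarith [mul_nonneg hS0 hlogk.le]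
  have := le_of_mul_le_mul_left hfinal hlogk
  exact_mod_cast this

/-- Large `k`. -/
lemma good_large (k L s m : ℕ) (hk : 8 ≤ k) (hL : k < 3 ^ L) (hm : k ≤ 2 ^ m) (hs : Nat.sqrt k ≤ s)
    (hmain : 3 * m * (2 * L * (s + 2) + s + 1) < k - 1) : BGood k := by
  set n := k / 2 with hn
  set N := ((Ioc n (2 * n)).filter Nat.Prime).card with hN
  have h1 := many_primes' n m (by omega) (by omega)
  rw [← hN] at h1
  have hs' : Nat.sqrt (2 * n) ≤ s := (Nat.sqrt_le_sqrt (by omega)).trans hs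
  have hNbig : 2 * L * (s + 2) < N := by
    by_contra hcon
    have : 3 * m * (N + Nat.sqrt (2 * n) + 1) ≤ 3 * m * (2 * L * (s + 2) + s + 1) :=
      Nat.mul_le_mul_left _ (by omega)
    omega
  set P := (Ioc (k / 2) k).filter (fun q => q.Prime ∧ bh q = 1) with hP
  set I := (Ioc (k / 2) k).filter (fun q => q.Prime ∧ bh q = -1) with hI
  have hPI : N ≤ P.card + I.card := by
    refine le_trans (Finset.card_le_card ?_) (Finset.card_union_le P I)
    intro q hq
    simp only [mem_filter, mem_Ioc, hP, hI, mem_union] at hq ⊢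
    rcases bh_sq q with h | h
    · left; exact ⟨⟨by omega, by omega⟩, hq.2, h⟩
    · right; exact ⟨⟨by omega, by omega⟩, hq.2, h⟩
  have hSk := bS_bound L k hL
  have hkey := key_bound k L (by omega) hL
  rw [← hI] at hkey
  by_cases hc : L ≤ P.card
  · refine good_caseA k (by omega) P ?_ (by omega)
    intro q hq
    simp only [hP, mem_filter, mem_Ioc] at hq
    exact ⟨hq.2.1, hq.1.1, hq.1.2, hq.2.2⟩
  · have hIc : 2 * L * (s + 1) + L ≤ I.card := by nlinarith
    have e : (L : ℤ) * (Nat.sqrt k + 1) ≤ L * (s + 1) := by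
      gcongr
    refine good_caseB k L (by omega) hL
      ((Ioc (Nat.sqrt k) k).filter (fun q => q.Prime ∧ bh q = 1)) I ?_ ?_ ?_ ?_
    · intro q hq
      simp only [mem_filter, mem_Ioc] at hq
      exact ⟨hq.2.1, Nat.sqrt_lt'.1 hq.1.1, hq.2.2⟩
    · zify at hIc
      nlinarith
    · intro q hq
      simp only [hI, mem_filter, mem_Ioc] at hq
      exact ⟨hq.2.1, hq.1.1, hq.1.2, hq.2.2⟩
    · nlinarith

/-- A block of primes `1 mod 3` settles every `k` between its top and twice its bottom. -/
lemma good_block (k lo hi r : ℕ) (P : List ℕ) (hnd : P.Nodup)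
    (hP : ∀ q ∈ P, q.Prime ∧ q % 3 = 1 ∧ lo ≤ q ∧ q ≤ hi) (hlo : 2 ≤ k)
    (h1 : hi ≤ k) (h2 : k < 2 * lo) (h3 : k < 3 ^ r) (hr : r ≤ 2 * P.length + 1) : BGood k := by
  refine good_caseA k hlo P.toFinset ?_ ?_
  · intro q hq
    obtain ⟨a, b, c, d⟩ := hP q (by simpa using hq)
    refine ⟨a, by omega, by omega, ?_⟩
    rw [bh_of_not_dvd q (by omega), if_pos b]
  · rw [List.toFinset_card_of_nodup hnd]
    have := (bS_bound r k h3).2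
    omega

lemma bS_two : bS 2 = 0 := by rw [bS_rec]; simp [bS_zero]
lemma bS_three : bS 3 = 1 := by rw [bS_rec]; simp [bS_one]
lemma bS_four : bS 4 = 2 := by rw [bS_rec]; simp [bS_one]
lemma bS_eight : bS 8 = 0 := by rw [bS_rec]; simp [bS_two]
lemma bS_nine : bS 9 = 1 := by rw [bS_rec]; simp [bS_three]
lemma bS_ten : bS 10 = 2 := by rw [bS_rec]; simp [bS_three]

lemma good_tiny (k : ℕ) (h2 : 2 ≤ k) (hk : k < 31) : BGood k := by
  rcases lt_or_ge k 7 with h | h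
  · have key : k = 4 ∨ bS k ≤ 1 := by
      interval_cases k <;> rw [bS_rec] <;>
      simp [bS_zero, bS_one, bS_two, bS_eight, bS_nine, bS_ten]
    rcases key with rfl | h
    · refine good_of_flip 4 {3} (by intro q hq; simp at hq; subst hq; norm_num) ?_
      simp [bS_four, bS_one, bh_three]
    · exact good_caseA k h2 ∅ (by simp) (by simpa using h)
  rcases lt_or_ge k 14 with h' | h'
  · exact good_block k 7 7 3 [7] (by simp) (by simp; norm_num) (by omega) h (by omega) (by omega)
      (by simp)
  rcases lt_or_ge k 26 with h'' | h''
  · exact good_block k 13 13 3 [13] (by simp) (by simp; norm_num) (by omega) (by omega) (by omega)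
      (by omega) (by simp)
  refine good_caseA k h2 {19} ?_ ?_
  · intro q hq
    simp at hq
    subst hq
    refine ⟨by norm_num, by omega, by omega, ?_⟩
    rw [bh_of_not_dvd 19 (by omega)]
    simp
  · interval_cases k <;> rw [bS_rec] <;>
      simp [bS_zero, bS_one, bS_two, bS_eight, bS_nine, bS_ten]

lemma good_small (k : ℕ) (hk2 : 2 ≤ k) (hk : k < 4 ^ 13) : BGood k := by
  norm_num at hk
  rcases lt_or_ge k 33554641 with hk | h
  swap
  · exact good_block k 33554467 33554641 17 [33554467, 33554473, 33554503, 33554509, 33554527, 33554581, 33554593, 33554641] (by simp) (by simp; norm_num) hk2 h (by omega)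
      (hk.trans_le (by norm_num)) (by simp)
  rcases lt_or_ge k 16777633 with hk | h
  swap
  · exact good_block k 16777333 16777633 16 [16777333, 16777381, 16777441, 16777447, 16777507, 16777531, 16777597, 16777633] (by simp) (by simp; norm_num) hk2 h (by omega)
      (hk.trans_le (by norm_num)) (by simp)
  rcases lt_or_ge k 8389081 with hk | h
  swap
  · exact good_block k 8388841 8389081 16 [8388841, 8388901, 8388949, 8389027, 8389039, 8389057, 8389063, 8389081] (by simp) (by simp; norm_num) hk2 h (by omega)
      (hk.trans_le (by norm_num)) (by simp)
  rcases lt_or_ge k 4194679 with hk | h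
  swap
  · exact good_block k 4194559 4194679 15 [4194559, 4194583, 4194601, 4194637, 4194643, 4194661, 4194679] (by simp) (by simp; norm_num) hk2 h (by omega)
      (hk.trans_le (by norm_num)) (by simp)
  rcases lt_or_ge k 2097481 with hk | h
  swap
  · exact good_block k 2097349 2097481 14 [2097349, 2097373, 2097397, 2097421, 2097427, 2097451, 2097481] (by simp) (by simp; norm_num) hk2 h (by omega)
      (hk.trans_le (by norm_num)) (by simp)
  rcases lt_or_ge k 1048897 with hk | h
  swap
  · exact good_block k 1048759 1048897 14 [1048759, 1048783, 1048807, 1048837, 1048867, 1048891, 1048897] (by simp) (by simp; norm_num) hk2 h (by omega)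
      (hk.trans_le (by norm_num)) (by simp)
  rcases lt_or_ge k 524683 with hk | h
  swap
  · exact good_block k 524497 524683 13 [524497, 524509, 524521, 524593, 524599, 524683] (by simp) (by simp; norm_num) hk2 h (by omega)
      (hk.trans_le (by norm_num)) (by simp)
  rcases lt_or_ge k 262459 with hk | h
  swap
  · exact good_block k 262351 262459 12 [262351, 262369, 262387, 262399, 262411, 262459] (by simp) (by simp; norm_num) hk2 h (by omega)
      (hk.trans_le (by norm_num)) (by simp)
  rcases lt_or_ge k 131413 with hk | h
  swap
  · exact good_block k 131251 131413 12 [131251, 131293, 131311, 131317, 131371, 131413] (by simp) (by simp; norm_num) hk2 h (by omega)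
      (hk.trans_le (by norm_num)) (by simp)
  rcases lt_or_ge k 65761 with hk | h
  swap
  · exact good_block k 65707 65761 11 [65707, 65713, 65719, 65731, 65761] (by simp) (by simp; norm_num) hk2 h (by omega)
      (hk.trans_le (by norm_num)) (by simp)
  rcases lt_or_ge k 32971 with hk | h
  swap
  · exact good_block k 32887 32971 11 [32887, 32911, 32917, 32941, 32971] (by simp) (by simp; norm_num) hk2 h (by omega)
      (hk.trans_le (by norm_num)) (by simp)
  rcases lt_or_ge k 16603 with hk | h
  swap
  · exact good_block k 16519 16603 10 [16519, 16561, 16567, 16573, 16603] (by simp) (by simp; norm_num) hk2 h (by omega)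
      (hk.trans_le (by norm_num)) (by simp)
  rcases lt_or_ge k 8353 with hk | h
  swap
  · exact good_block k 8311 8353 9 [8311, 8317, 8329, 8353] (by simp) (by simp; norm_num) hk2 h (by omega)
      (hk.trans_le (by norm_num)) (by simp)
  rcases lt_or_ge k 4231 with hk | h
  swap
  · exact good_block k 4177 4231 9 [4177, 4201, 4219, 4231] (by simp) (by simp; norm_num) hk2 h (by omega)
      (hk.trans_le (by norm_num)) (by simp)
  rcases lt_or_ge k 2161 with hk | h
  swap
  · exact good_block k 2131 2161 8 [2131, 2137, 2143, 2161] (by simp) (by simp; norm_num) hk2 h (by omega)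
      (hk.trans_le (by norm_num)) (by simp)
  rcases lt_or_ge k 1117 with hk | h
  swap
  · exact good_block k 1087 1117 7 [1087, 1093, 1117] (by simp) (by simp; norm_num) hk2 h (by omega)
      (hk.trans_le (by norm_num)) (by simp)
  rcases lt_or_ge k 601 with hk | h
  swap
  · exact good_block k 571 601 7 [571, 577, 601] (by simp) (by simp; norm_num) hk2 h (by omega)
      (hk.trans_le (by norm_num)) (by simp)
  rcases lt_or_ge k 331 with hk | h
  swap
  · exact good_block k 307 331 6 [307, 313, 331] (by simp) (by simp; norm_num) hk2 h (by omega)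
      (hk.trans_le (by norm_num)) (by simp)
  rcases lt_or_ge k 199 with hk | h
  swap
  · exact good_block k 181 199 6 [181, 193, 199] (by simp) (by simp; norm_num) hk2 h (by omega)
      (hk.trans_le (by norm_num)) (by simp)
  rcases lt_or_ge k 109 with hk | h
  swap
  · exact good_block k 103 109 5 [103, 109] (by simp) (by simp; norm_num) hk2 h (by omega)
      (hk.trans_le (by norm_num)) (by simp)
  rcases lt_or_ge k 67 with hk | h
  swap
  · exact good_block k 61 67 5 [61, 67] (by simp) (by simp; norm_num) hk2 h (by omega)
      (hk.trans_le (by norm_num)) (by simp)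
  rcases lt_or_ge k 43 with hk | h
  swap
  · exact good_block k 37 43 4 [37, 43] (by simp) (by simp; norm_num) hk2 h (by omega)
      (hk.trans_le (by norm_num)) (by simp)
  rcases lt_or_ge k 37 with hk | h
  swap
  · exact good_block k 31 37 4 [31, 37] (by simp) (by simp; norm_num) hk2 h (by omega)
      (hk.trans_le (by norm_num)) (by simp)
  rcases lt_or_ge k 31 with hk | h
  swap
  · exact good_block k 19 31 4 [19, 31] (by simp) (by simp; norm_num) hk2 h (by omega)
      (hk.trans_le (by norm_num)) (by simp)
  exact good_tiny k hk2 hk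

lemma large_ineq (t : ℕ) (ht : 13 ≤ t) : (2 * t + 2) * (16 * t + 31) + 2 ≤ 2 ^ t := by
  induction t, ht using Nat.le_induction with
  | base => norm_num
  | succ t ht ih => rw [pow_succ]; nlinarith

theorem balanced_cascades_aux (k : ℕ) (hk : 2 ≤ k) : BGood k := by
  rcases lt_or_ge k (4 ^ 13) with h | h
  · exact good_small k hk h
  set t := Nat.log 4 k with htdef
  have ht : 13 ≤ t := (Nat.le_log_iff_pow_le (by norm_num) (by omega)).2 h
  have hlow : 4 ^ t ≤ k := Nat.pow_log_le_self 4 (by omega)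
  have hup : k < 4 ^ (t + 1) := Nat.lt_pow_succ_log_self (by norm_num) k
  set L := (4 * t + 6) / 3 with hLdef
  have hL : 4 ^ (t + 1) ≤ 3 ^ L := by
    rw [← Nat.pow_le_pow_iff_left (n := 3) (by norm_num)]
    calc (4 ^ (t + 1)) ^ 3 = 64 ^ (t + 1) := by rw [← pow_mul, mul_comm, pow_mul]; norm_num
      _ ≤ 81 ^ (t + 1) := Nat.pow_le_pow_left (by norm_num) _
      _ = 3 ^ (4 * (t + 1)) := by rw [pow_mul]; norm_num
      _ ≤ 3 ^ (L * 3) := Nat.pow_le_pow_right (by norm_num) (by omega)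
      _ = _ := by rw [pow_mul]
  have hY := large_ineq t ht
  have h4 : 4 ^ t = 2 ^ t * 2 ^ t := by rw [← mul_pow]; norm_num
  set Y := 2 ^ t with hYdef
  have h4' : 4 ^ (t + 1) = (2 * Y) ^ 2 := by rw [pow_succ, h4]; ring
  have hs : Nat.sqrt k < 2 * Y := Nat.sqrt_lt'.2 (by omega)
  refine good_large k L (2 * Y - 1) (2 * t + 2) (by omega) (by omega) ?_ (by omega) ?_
  · have : 2 ^ (2 * t + 2) = 4 ^ (t + 1) := by
      rw [show 2 * t + 2 = 2 * (t + 1) by ring, pow_mul]; norm_num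
    omega
  · have e1 : 2 * Y - 1 + 2 = 2 * Y + 1 := by omega
    have e2 : 2 * L * (2 * Y - 1 + 2) + (2 * Y - 1) + 1 = 2 * L * (2 * Y + 1) + 2 * Y := by
      rw [e1]; omega
    rw [e2]
    have e3 : 3 * L ≤ 4 * t + 6 := by omega
    have e4 : 3 * (2 * t + 2) * (2 * L * (2 * Y + 1) + 2 * Y) ≤
        (2 * t + 2) * (2 * (4 * t + 6) * (2 * Y + 1) + 6 * Y) := by
      calc _ = (2 * t + 2) * (2 * (3 * L) * (2 * Y + 1) + 6 * Y) := by ring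
        _ ≤ _ := by gcongr
    have e5 : 8 * t + 12 ≤ Y := by nlinarith
    have e6 : (2 * t + 2) * (2 * (4 * t + 6) * (2 * Y + 1) + 6 * Y) ≤
        ((2 * t + 2) * (16 * t + 31)) * Y := by
      calc _ = (2 * t + 2) * ((16 * t + 30) * Y + (8 * t + 12)) := by ring
        _ ≤ (2 * t + 2) * ((16 * t + 30) * Y + Y) := by gcongr
        _ = _ := by ring
    have e7 : ((2 * t + 2) * (16 * t + 31) + 2) * Y ≤ Y * Y := Nat.mul_le_mul_right _ hY
    have e8 : ((2 * t + 2) * (16 * t + 31) + 2) * Y = ((2 * t + 2) * (16 * t + 31)) * Y + 2 * Y := by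
      ring
    omega

/-- **Balanced cascades**: for every `k ≥ 2` there is a `2`-coloring
`f : ℕ⁺ → {-1,+1}` such that every cascade `{d, 2d, …, kd}` of length `k` is balanced:
`|∑_{i=1}^{k} f(i·d)| ≤ 1` for all `d ≥ 1`. -/
theorem balanced_cascades (k : ℕ) (hk : 2 ≤ k) :
    ∃ f : ℕ → ℤ,
      (∀ n : ℕ, 1 ≤ n → f n = 1 ∨ f n = -1) ∧
      ∀ d : ℕ, 1 ≤ d → |∑ i ∈ Finset.Icc 1 k, f (i * d)| ≤ 1 :=
  balanced_cascades_aux k hk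
end
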